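/- arXiv:2102.02610 — 2 statements merged into one kernel-verified Lean document; each statement's English description precedes it below -/
import Mathlib

section
/- Every onto, strategyproof mechanism f on a discrete tree is 1-tree step independent (1-TSI): for every profile a, agent i, and a'_i ∈ V such that d([a_i, a'_i], f(a)) > 1, it holds that tree(a_i → a'_i, f(a)) = tree(a_i → a'_i, f(a_{-i}, a'_i)). -/
open Function

/-- `T = (V,E)` is a discrete tree: connected, acyclic, bounded degree. -/
def IsDiscreteTree {V : Type*} (G : SimpleGraph V) : Prop :=
  G.Connected ∧ G.IsAcyclic ∧
    ∃ D : ℕ, ∀ v : V, (G.neighborSet v).Finite ∧ (G.neighborSet v).ncard ≤ D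

/-- `pathSet G u w` is the vertex set of the unique path `[u,w]`
(in a tree, exactly the vertices lying on a geodesic from `u` to `w`). -/
def pathSet {V : Type*} (G : SimpleGraph V) (u w : V) : Set V :=
  {v | G.dist u v + G.dist v w = G.dist u w}

/-- `subtree G a b v` = `tree(a → b, v)`: the set of vertices reachable from `v`
via edges that do not lie on the path `[a,b]`. -/
def subtree {V : Type*} (G : SimpleGraph V) (a b v : V) : Set V :=
  {u | Relation.ReflTransGen
        (fun x y => G.Adj x y ∧ ¬(x ∈ pathSet G a b ∧ y ∈ pathSet G a b)) v u}

/-- Distance from a vertex to a set of vertices. -/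
noncomputable def distToSet {V : Type*} (G : SimpleGraph V) (x : V) (S : Set V) : ℕ :=
  sInf (G.dist x '' S)

/-- Distance between two sets of vertices. -/
noncomputable def setDist {V : Type*} (G : SimpleGraph V) (A B : Set V) : ℕ :=
  sInf {d : ℕ | ∃ u ∈ A, ∃ w ∈ B, G.dist u w = d}

/-- `depth(a → b, v)`: the distance of `v` from the path `[a,b]`. -/
noncomputable def depth {V : Type*} (G : SimpleGraph V) (a b v : V) : ℕ :=
  distToSet G v (pathSet G a b)

/-- A mechanism is strategyproof if no agent can get the facility strictly
closer to her true location by misreporting. -/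
def Strategyproof {V : Type*} {n : ℕ} (G : SimpleGraph V)
    (f : (Fin n → V) → V) : Prop :=
  ∀ (a : Fin n → V) (i : Fin n) (b : V),
    G.dist (a i) (f a) ≤ G.dist (a i) (f (Function.update a i b))

/-- 1-tree step independent (1-TSI): if the facility is at distance more than 1
from the trajectory of the deviating agent, it stays in the same tree
w.r.t. the move. -/
def OneTSI {V : Type*} {n : ℕ} (G : SimpleGraph V) (f : (Fin n → V) → V) : Prop :=
  ∀ (a : Fin n → V) (i : Fin n) (b : V),
    distToSet G (f a) (pathSet G (a i) b) > 1 →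
    subtree G (a i) b (f a) = subtree G (a i) b (f (Function.update a i b))

namespace SimpleGraph

variable {V : Type*} {G : SimpleGraph V}

lemma Walk.dist_add_dist_le_length {x w c : V} (p : G.Walk x w)
    (hc : c ∈ p.support) : G.dist x c + G.dist c w ≤ p.length := by
  classical
  have h := congrArg Walk.length (p.take_spec hc)
  rw [Walk.length_append] at h
  have h1 := dist_le (p.takeUntil c hc)
  have h2 := dist_le (p.dropUntil c hc)
  omega

lemma Connected.exists_adj_dist_add_one (hG : G.Connected) {x w : V} (h : x ≠ w) :
    ∃ y, G.Adj x y ∧ G.dist x w = G.dist y w + 1 := by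
  obtain ⟨p, hp⟩ := hG.exists_walk_length_eq_dist x w
  cases p with
  | nil => exact absurd rfl h
  | @cons _ y _ hxy q =>
    refine ⟨y, hxy, ?_⟩
    have h1 := dist_le q
    have h2 := hG.dist_triangle (u := x) (v := y) (w := w)
    rw [dist_eq_one_iff_adj.2 hxy] at h2
    rw [Walk.length_cons] at hp
    omega

/-- A geodesic joining the two sides of an edge of a tree runs through that edge. -/
lemma IsTree.dist_eq_of_sides (hG : G.IsTree) {y y' x w : V} (hadj : G.Adj y y')
    (hx : G.dist y' x = G.dist y x + 1) (hw : G.dist y w = G.dist y' w + 1) :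
    G.dist x w = G.dist x y + 1 + G.dist y' w := by
  have hC := hG.connected
  have hb := isAcyclic_iff_forall_adj_isBridge.1 hG.isAcyclic hadj
  rw [isBridge_iff_forall_walk_mem_edges] at hb
  obtain ⟨p, hp⟩ := hC.exists_walk_length_eq_dist x w
  obtain ⟨r, hr⟩ := hC.exists_walk_length_eq_dist y x
  obtain ⟨q, hq⟩ := hC.exists_walk_length_eq_dist w y'
  have hmem := hb ((r.append p).append q)
  rw [Walk.edges_append, Walk.edges_append, List.mem_append, List.mem_append] at hmem
  have c2 := G.dist_comm (u := w) (v := y')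
  have c3 := G.dist_comm (u := w) (v := y)
  rcases hmem with (h | h) | h
  · have := Walk.dist_add_dist_le_length r (r.snd_mem_support_of_mem_edges h)
    omega
  · have := Walk.dist_add_dist_le_length p (p.fst_mem_support_of_mem_edges h)
    have := hC.dist_triangle (u := x) (v := y) (w := w)
    omega
  · have := Walk.dist_add_dist_le_length q (q.fst_mem_support_of_mem_edges h)
    omega

/-- Any three vertices of a tree have a median. -/
lemma IsTree.exists_median (hG : G.IsTree) (a b z : V) :
    ∃ m, G.dist a m + G.dist m b = G.dist a b ∧ G.dist a m + G.dist m z = G.dist a z ∧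
      G.dist b m + G.dist m z = G.dist b z := by
  have hC := hG.connected
  induction hn : G.dist a b generalizing a with
  | zero =>
    obtain rfl := hC.dist_eq_zero_iff.1 hn
    exact ⟨a, by simp⟩
  | succ n ih =>
    have hab : a ≠ b := by rintro rfl; simp at hn
    obtain ⟨a', hadj, ha'⟩ := hC.exists_adj_dist_add_one hab
    have h1 := dist_eq_one_iff_adj.2 hadj
    rcases hG.dist_eq_dist_add_one_of_adj z hadj with hz | hz
    · obtain ⟨m, hm1, hm2, hm3⟩ := ih a' (by omega)
      have t1 := hC.dist_triangle (u := a) (v := a') (w := m)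
      have t2 := hC.dist_triangle (u := a) (v := m) (w := b)
      rw [G.dist_comm (u := z), G.dist_comm (u := z)] at hz
      exact ⟨m, by omega, by omega, hm3⟩
    · rw [G.dist_comm (u := z), G.dist_comm (u := z)] at hz
      have h := hG.dist_eq_of_sides hadj hz ha'
      have c1 := G.dist_comm (u := z) (v := a)
      have c2 := G.dist_comm (u := z) (v := b)
      have c3 := G.dist_comm (u := a) (v := b)
      refine ⟨a, by simpa using hn, by simp, by omega⟩

end SimpleGraph

section Subtree

variable {V : Type*} {G : SimpleGraph V}

lemma subtree_eq_of_mem {a b u v : V} (h : u ∈ subtree G a b v) :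
    subtree G a b v = subtree G a b u := by
  have hsymm : Std.Symm
      (fun x y => G.Adj x y ∧ ¬(x ∈ pathSet G a b ∧ y ∈ pathSet G a b)) :=
    ⟨fun x y hxy => ⟨hxy.1.symm, fun hc => hxy.2 hc.symm⟩⟩
  have h' := Relation.ReflTransGen.stdSymm.symm _ _ h
  ext x
  exact ⟨fun hx => h'.trans hx, fun hx => Relation.ReflTransGen.trans h hx⟩

/-- A vertex lies in the same subtree as its projection on the path. -/
lemma mem_subtree_of_proj (hC : G.Connected) {a b p z : V}
    (hp : G.dist a p + G.dist p b = G.dist a b)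
    (ha : G.dist a p + G.dist p z = G.dist a z)
    (hb : G.dist b p + G.dist p z = G.dist b z) : p ∈ subtree G a b z := by
  induction hn : G.dist p z generalizing z with
  | zero =>
    obtain rfl := hC.dist_eq_zero_iff.1 hn
    exact Relation.ReflTransGen.refl
  | succ n ih =>
    have hzp : z ≠ p := by rintro rfl; simp at hn
    obtain ⟨z', hadj, hz'⟩ := hC.exists_adj_dist_add_one hzp
    have h1 := SimpleGraph.dist_eq_one_iff_adj.2 hadj
    have c1 := G.dist_comm (u := z) (v := p)
    have c2 := G.dist_comm (u := z') (v := p)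
    have c3 := G.dist_comm (u := z) (v := z')
    have c4 := G.dist_comm (u := z) (v := b)
    have c5 := G.dist_comm (u := p) (v := b)
    have t1 := hC.dist_triangle (u := a) (v := p) (w := z')
    have t2 := hC.dist_triangle (u := a) (v := z') (w := z)
    have t3 := hC.dist_triangle (u := b) (v := p) (w := z')
    have t4 := hC.dist_triangle (u := b) (v := z') (w := z)
    refine Relation.ReflTransGen.head ⟨hadj, fun hc => ?_⟩
      (ih (z := z') (by omega) (by omega) (by omega))
    have : G.dist a z + G.dist z b = G.dist a b := hc.1
    omega

end Subtree

section Mechanism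

variable {V : Type*} {n : ℕ} {G : SimpleGraph V} {f : (Fin n → V) → V}

/-- Changing a profile `a` into `c` one coordinate at a time. -/
lemma profile_induction {P : (Fin n → V) → Prop} (a c : Fin n → V) (h0 : P a)
    (hstep : ∀ a' j, (a' j = a j ∨ a' j = c j) → P a' → P (update a' j (c j))) : P c := by
  classical
  have key : ∀ s : Finset (Fin n), P (s.piecewise c a) := by
    intro s
    induction s using Finset.induction_on with
    | empty => simpa using h0
    | insert j s _ ih =>
      rw [Finset.piecewise_insert]
      refine hstep _ j ?_ ih
      by_cases hj : j ∈ s <;> simp [hj]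
  simpa using key Finset.univ

lemma Strategyproof.dist_update_le (hSP : Strategyproof G f) (a : Fin n → V) (i : Fin n)
    (x y : V) : G.dist x (f (update a i x)) ≤ G.dist x (f (update a i y)) := by
  simpa using hSP (update a i x) i y

/-- Reporting `y` brings the facility no further from `y`. -/
lemma Strategyproof.dist_update_le_self (hSP : Strategyproof G f) (a : Fin n → V) (j : Fin n)
    (y : V) : G.dist y (f (update a j y)) ≤ G.dist y (f a) := by
  simpa using hSP.dist_update_le a j y (a j)

lemma Strategyproof.unanimous (hSP : Strategyproof G f) (hC : G.Connected)
    (hOnto : Surjective f) (y : V) : f (fun _ => y) = y := by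
  obtain ⟨a, ha⟩ := hOnto y
  refine profile_induction (P := fun a => f a = y) a _ ha fun a' j _ h => ?_
  have := hSP.dist_update_le_self a' j y
  rw [h, SimpleGraph.dist_self, Nat.le_zero, hC.dist_eq_zero_iff] at this
  exact this.symm

/-- If agent `i` crossing the edge `y y'` makes the facility jump across this edge, then the
facility lands at distance at most one from the edge (when the landing side is the further one). -/
lemma Strategyproof.dist_le_one_of_le (hSP : Strategyproof G f) (hT : G.IsTree)
    (hOnto : Surjective f) {y y' : V} (hadj : G.Adj y y') (a : Fin n → V) (i : Fin n)
    (hu : G.dist y' (f (update a i y)) = G.dist y (f (update a i y)) + 1)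
    (hw : G.dist y (f (update a i y')) = G.dist y' (f (update a i y')) + 1)
    (hle : G.dist y (f (update a i y)) ≤ G.dist y' (f (update a i y'))) :
    G.dist y' (f (update a i y')) ≤ 1 := by
  classical
  have hC := hT.connected
  by_contra! hβ
  have sides (v : V) : G.dist y v = G.dist y' v + 1 ∨ G.dist y' v = G.dist y v + 1 := by
    simpa only [G.dist_comm (u := v)] using hT.dist_eq_dist_add_one_of_adj v hadj
  let c : Fin n → V := fun j => if G.dist y' (a j) = G.dist y (a j) + 1 then y else a j
  let P : (Fin n → V) → Prop := fun b =>
    G.dist y' (f (update b i y)) = G.dist y (f (update b i y)) + 1 ∧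
    G.dist y (f (update b i y')) = G.dist y' (f (update b i y')) + 1 ∧
    G.dist y (f (update b i y)) ≤ G.dist y' (f (update b i y')) ∧
    2 ≤ G.dist y' (f (update b i y'))
  have hPc : P c := by
    refine profile_induction a c ⟨hu, hw, hle, hβ⟩ fun b j hj hP => ?_
    rcases eq_or_ne j i with rfl | hji
    · simpa only [P, update_idem] using hP
    by_cases hbc : b j = c j
    · rwa [← hbc, update_eq_self]
    have hba : b j = a j := hj.resolve_right hbc
    have hside : G.dist y' (a j) = G.dist y (a j) + 1 := by
      by_contra hs
      exact hbc (by simp [c, hs, hba])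
    have hcj : c j = y := if_pos hside
    obtain ⟨h1, h2, h3, h4⟩ := hP
    have e1 := hSP (update b i y') j y
    rw [update_of_ne hji, hba] at e1
    have e2 := hSP.dist_update_le_self (update b i y') j y
    have e3 := hSP.dist_update_le_self (update b i y) j y
    rw [update_comm hji.symm] at e1 e2 e3
    have e4 := hSP.dist_update_le (update b j y) i y' y
    have b1 := hT.dist_eq_of_sides hadj hside h2
    have t1 := hC.dist_triangle (u := a j) (v := y) (w := f (update (update b j y) i y'))
    have s1 := sides (f (update (update b j y) i y))
    have s2 := sides (f (update (update b j y) i y'))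
    simp only [P, hcj]
    omega
  obtain ⟨h1, h2, h3, h4⟩ := hPc
  have e0 := hSP.dist_update_le c i y' y
  have hfin : G.dist y' (f fun _ => y) = G.dist y (f fun _ => y) + 1 ∧
      1 ≤ G.dist y (f fun _ => y) := by
    refine profile_induction (P := fun b => G.dist y' (f b) = G.dist y (f b) + 1 ∧
      1 ≤ G.dist y (f b)) (update c i y) _ ⟨h1, by omega⟩ fun b j hj hP => ?_
    by_cases hby : b j = y
    · rwa [show update b j y = b from hby ▸ update_eq_self j b]
    have hside : G.dist y (b j) = G.dist y' (b j) + 1 := by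
      have hb := hj.resolve_right hby
      have hji : j ≠ i := by
        rintro rfl
        exact hby (by simp [hb])
      rw [update_of_ne hji] at hb
      have hs : ¬ G.dist y' (a j) = G.dist y (a j) + 1 := fun hs => hby (by simp [hb, c, hs])
      have : b j = a j := by simp [hb, c, hs]
      rw [this]
      exact (sides (a j)).resolve_right hs
    obtain ⟨hP1, hP2⟩ := hP
    have e1 := hSP b j y
    have e2 := hSP.dist_update_le_self b j y
    have b1 := hT.dist_eq_of_sides hadj hP1 hside
    have c1 := G.dist_comm (u := f b) (v := b j)
    have c2 := G.dist_comm (u := f b) (v := y)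
    have c3 := G.dist_comm (u := b j) (v := y')
    have t1 := hC.dist_triangle (u := b j) (v := y') (w := f (update b j y))
    have s1 := sides (f (update b j y))
    omega
  rw [hSP.unanimous hC hOnto, SimpleGraph.dist_self] at hfin
  omega

/-- If agent `i` crossing the edge `y y'` makes the facility jump across this edge, then the
facility moves between vertices at distance at most one from the edge. -/
lemma Strategyproof.dist_le_one (hSP : Strategyproof G f) (hT : G.IsTree)
    (hOnto : Surjective f) {y y' : V} (hadj : G.Adj y y') (a : Fin n → V) (i : Fin n)
    (hu : G.dist y' (f (update a i y)) = G.dist y (f (update a i y)) + 1)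
    (hw : G.dist y (f (update a i y')) = G.dist y' (f (update a i y')) + 1) :
    G.dist y (f (update a i y)) ≤ 1 ∧ G.dist y' (f (update a i y')) ≤ 1 := by
  rcases le_total (G.dist y (f (update a i y))) (G.dist y' (f (update a i y'))) with h | h
  · have := hSP.dist_le_one_of_le hT hOnto hadj a i hu hw h
    omega
  · have := hSP.dist_le_one_of_le hT hOnto hadj.symm a i hw hu h
    omega

/-- The closest outcomes agent `i` can achieve from `y`, if not adjacent to `y`, all lie in the
same direction from `y`. -/
lemma Strategyproof.not_opposite_of_dist_eq (hSP : Strategyproof G f) (hT : G.IsTree)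
    (hOnto : Surjective f) (a : Fin n → V) (i : Fin n) (y x : V)
    (h2 : 2 ≤ G.dist y (f (update a i y)))
    (heq : G.dist y (f (update a i x)) = G.dist y (f (update a i y))) :
    G.dist (f (update a i y)) (f (update a i x)) ≠
      G.dist y (f (update a i y)) + G.dist y (f (update a i x)) := by
  intro hop
  have hC := hT.connected
  have hne : y ≠ f (update a i x) := by
    intro h
    rw [← h, SimpleGraph.dist_self] at heq
    omega
  obtain ⟨y', hadj, hy'⟩ := hC.exists_adj_dist_add_one hne
  have e1 := hSP.dist_update_le a i y' x
  have e2 := hSP.dist_update_le a i y y'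
  have s1 := hT.dist_eq_dist_add_one_of_adj (f (update a i y)) hadj
  have s2 := hT.dist_eq_dist_add_one_of_adj (f (update a i y')) hadj
  have t1 := hC.dist_triangle (u := f (update a i y)) (v := y') (w := f (update a i x))
  simp only [G.dist_comm (u := f (update a i y)) (v := y),
    G.dist_comm (u := f (update a i y)) (v := y'),
    G.dist_comm (u := f (update a i y')) (v := y),
    G.dist_comm (u := f (update a i y')) (v := y')] at s1 s2 t1
  have := hSP.dist_le_one hT hOnto hadj a i (by omega) (by omega)
  omega

/-- While agent `i` approaches `w` along a geodesic, a facility lying at distance at least two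
behind the agent stays behind. -/
lemma Strategyproof.stays_behind (hSP : Strategyproof G f) (hT : G.IsTree)
    (hOnto : Surjective f) (a : Fin n → V) (i : Fin n) {c q w : V}
    (hcq : G.dist c w = G.dist c q + G.dist q w)
    (h2 : 2 ≤ G.dist c (f (update a i c)))
    (hb : G.dist (f (update a i c)) w = G.dist c (f (update a i c)) + G.dist c w) :
    2 ≤ G.dist q (f (update a i q)) ∧
      G.dist (f (update a i q)) w = G.dist q (f (update a i q)) + G.dist q w := by
  have hC := hT.connected
  induction hn : G.dist c q generalizing c with
  | zero =>
    obtain rfl := hC.dist_eq_zero_iff.1 hn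
    exact ⟨h2, hb⟩
  | succ n ih =>
    have hne : c ≠ q := by rintro rfl; simp at hn
    obtain ⟨c', hadj, hc'⟩ := hC.exists_adj_dist_add_one hne
    have t2 := hC.dist_triangle (u := c') (v := q) (w := w)
    have t3 := hC.dist_triangle (u := f (update a i c)) (v := c') (w := w)
    have e1 := hSP.dist_update_le a i c c'
    have s1 := hT.dist_eq_dist_add_one_of_adj (f (update a i c)) hadj
    have s2 := hT.dist_eq_dist_add_one_of_adj (f (update a i c')) hadj
    simp only [G.dist_comm (u := f (update a i c)) (v := c),
      G.dist_comm (u := f (update a i c)) (v := c'),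
      G.dist_comm (u := f (update a i c')) (v := c),
      G.dist_comm (u := f (update a i c')) (v := c')] at s1 s2 t3
    have hside : G.dist c' (f (update a i c')) = G.dist c (f (update a i c')) + 1 := by
      refine s2.resolve_left fun hs => ?_
      have := hSP.dist_le_one hT hOnto hadj a i (by omega) hs
      omega
    have b1 := hT.dist_eq_of_sides hadj hside (w := w) (by omega)
    rw [G.dist_comm (u := f (update a i c')) (v := c)] at b1
    exact ih (c := c') (by omega) (by omega) (by omega) (by omega)

end Mechanism

/-- every onto, strategyproof mechanism on a discrete tree is
1-tree step independent (1-TSI). -/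
theorem onto_sp_implies_one_tsi {V : Type*} {n : ℕ} (G : SimpleGraph V)
    (hT : IsDiscreteTree G) (f : (Fin n → V) → V)
    (hSP : Strategyproof G f) (hOnto : Function.Surjective f) :
    OneTSI G f := by
  intro a i b hd
  have hC : G.Connected := hT.1
  have hG : G.IsTree := ⟨hC, hT.2.1⟩
  have hfa : update a i (a i) = a := update_eq_self i a
  obtain ⟨p, hp1, hp2, hp3⟩ := hG.exists_median (a i) b (f a)
  have hpz := mem_subtree_of_proj hC hp1 hp2 hp3
  have hpath : 2 ≤ G.dist p (f a) := by
    rw [G.dist_comm]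
    exact (Nat.succ_le_of_lt hd).trans (Nat.sInf_le ⟨p, hp1, rfl⟩)
  obtain ⟨q, hq1, hq2, hq3⟩ := hG.exists_median p b (f (update a i b))
  have ea := hSP a i b
  have eb := hSP.dist_update_le a i b (a i)
  rw [hfa] at eb
  rcases eq_or_ne p q with rfl | hpq
  · obtain ⟨r, hr1, hr2, hr3⟩ := hG.exists_median (a i) p (f (update a i b))
    have hrp : G.dist r p = 0 := by
      have := G.dist_comm (u := r) (v := p)
      omega
    obtain rfl := hC.dist_eq_zero_iff.1 hrp
    have hpw := mem_subtree_of_proj hC hp1 hr2 hq3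
    rw [subtree_eq_of_mem hpz, subtree_eq_of_mem hpw]
  · exfalso
    obtain ⟨c, hadj, hc⟩ := hC.exists_adj_dist_add_one hpq
    have h1 := SimpleGraph.dist_eq_one_iff_adj.2 hadj
    have cbp := G.dist_comm (u := b) (v := p)
    have ccb := G.dist_comm (u := c) (v := b)
    have u1 := hSP.dist_update_le a i p (a i)
    have u2 := hSP.dist_update_le a i (a i) p
    rw [hfa] at u1 u2
    have t1 := hC.dist_triangle (u := a i) (v := p) (w := f (update a i p))
    have hu : G.dist p (f (update a i p)) = G.dist p (f a) := by omega
    have t2 := hC.dist_triangle (u := c) (v := q) (w := b)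
    have t3 := hC.dist_triangle (u := c) (v := q) (w := f (update a i b))
    have t4 := hC.dist_triangle (u := b) (v := c) (w := f a)
    have t5 := hC.dist_triangle (u := p) (v := c) (w := f (update a i b))
    have s1 := hG.dist_eq_dist_add_one_of_adj (f a) hadj
    have s2 := hG.dist_eq_dist_add_one_of_adj (f (update a i p)) hadj
    simp only [G.dist_comm (u := f a), G.dist_comm (u := f (update a i p))] at s1 s2
    have hside : G.dist c (f (update a i p)) = G.dist p (f (update a i p)) + 1 := by
      refine s2.resolve_left fun hs => ?_
      have hz := hG.dist_eq_of_sides hadj (x := f a) (by omega) hs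
      rw [G.dist_comm (u := f a) (v := p), G.dist_comm (u := f a)] at hz
      have := hSP.not_opposite_of_dist_eq hG hOnto a i p (a i) (by omega)
      rw [hfa] at this
      exact this hu.symm (by omega)
    have hbeh := hG.dist_eq_of_sides hadj hside (w := f (update a i b)) (by omega)
    rw [G.dist_comm (u := f (update a i p)) (v := p)] at hbeh
    obtain ⟨hv2, hv⟩ := hSP.stays_behind hG hOnto a i (c := p) (q := q)
      (w := f (update a i b)) (by omega) (by omega) (by omega)
    have v1 := hSP.dist_update_le a i q b
    have v2 := hSP.dist_update_le a i b q
    have t6 := hC.dist_triangle (u := b) (v := q) (w := f (update a i q))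
    exact hSP.not_opposite_of_dist_eq hG hOnto a i q b hv2 (by omega) hv
end

section
/- Every mechanism f on a discrete tree that is tree monotone (TMON) and almost trajectory contained (ATC, i.e., both ADR and 1-TSI) is strategyproof. -/
open Function

/-- Tree monotone (TMON): on the common part of the agent's trajectory and the
facility's trajectory, the facility moves in the same direction as the agent. -/
def TMON {V : Type*} {n : ℕ} (G : SimpleGraph V) (f : (Fin n → V) → V) : Prop :=
  ∀ (a : Fin n → V) (i : Fin n) (b : V),
    ∀ x ∈ pathSet G (a i) b ∩ pathSet G (f a) (f (Function.update a i b)),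
      ∀ y ∈ pathSet G (a i) b ∩ pathSet G (f a) (f (Function.update a i b)),
        (G.dist (a i) x < G.dist (a i) y ↔ G.dist (f a) x < G.dist (f a) y)

/-- Almost depth restricted (ADR): whenever a single agent's deviation moves
the facility within the same tree (w.r.t. the move), the old and new outcomes
are both at distance exactly 1 from the meeting point `z` of the three paths. -/
def ADR {V : Type*} {n : ℕ} (G : SimpleGraph V) (f : (Fin n → V) → V) : Prop :=
  ∀ (a : Fin n → V) (i : Fin n) (b : V),
    f a ≠ f (Function.update a i b) →
    subtree G (a i) b (f a) = subtree G (a i) b (f (Function.update a i b)) →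
    ∀ z ∈ pathSet G (a i) (f a) ∩ pathSet G (a i) (f (Function.update a i b)) ∩
            pathSet G (f a) (f (Function.update a i b)),
      G.dist (f a) z = G.dist (f (Function.update a i b)) z ∧
      G.dist (f a) z = 1

namespace SimpleGraph

variable {V : Type*} {G : SimpleGraph V}

/-- In a tree, two geodesics that meet only at their common endpoint concatenate to a geodesic. -/
theorem dist_add_of_inter_subset (hc : G.Connected) (ha : G.IsAcyclic) {u p x : V}
    (h : ∀ y ∈ pathSet G u p, y ∈ pathSet G p x → y = p) :
    G.dist u p + G.dist p x = G.dist u x := by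
  classical
  have mem_pathSet {s t y : V} (w : G.Walk s t) (hw : w.length = G.dist s t)
      (hy : y ∈ w.support) : y ∈ pathSet G s t := by
    have h1 := dist_le (w.takeUntil y hy)
    have h2 := dist_le (w.dropUntil y hy)
    have h3 := congrArg Walk.length (w.take_spec hy)
    rw [Walk.length_append] at h3
    have h4 := hc.dist_triangle (u := s) (v := y) (w := t)
    simp only [pathSet, Set.mem_ofPred_eq]
    omega
  obtain ⟨w₁, hw₁⟩ := hc.exists_walk_length_eq_dist u p
  obtain ⟨w₂, hw₂⟩ := hc.exists_walk_length_eq_dist p x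
  obtain ⟨w, hw⟩ := hc.exists_walk_length_eq_dist u x
  have hw₂p := w₂.isPath_of_length_eq_dist hw₂
  have hpath : (w₁.append w₂).IsPath := by
    rw [Walk.isPath_def, Walk.support_append]
    refine List.nodup_append.2 ⟨(w₁.isPath_of_length_eq_dist hw₁).support_nodup,
      hw₂p.support_nodup.tail, ?_⟩
    rintro y hy₁ z hy₂ rfl
    have hyp := h y (mem_pathSet w₁ hw₁ hy₁) (mem_pathSet w₂ hw₂ (List.mem_of_mem_tail hy₂))
    subst hyp
    have hnodup := hw₂p.support_nodup
    rw [← Walk.cons_tail_support] at hnodup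
    exact (List.nodup_cons.1 hnodup).1 hy₂
  have heq : w₁.append w₂ = w := congrArg Subtype.val ((ha.subsingleton_path u x).elim
    ⟨w₁.append w₂, hpath⟩ ⟨w, w.isPath_of_length_eq_dist hw⟩)
  have hlen := congrArg Walk.length heq
  rw [Walk.length_append] at hlen
  omega

/-- In a tree, the vertices of a path are linearly ordered by their distance from its start. -/
theorem dist_add_of_dist_le (hc : G.Connected) (ha : G.IsAcyclic) {a b x m : V}
    (hx : x ∈ pathSet G a b) (hm : m ∈ pathSet G a b) (h : G.dist a x ≤ G.dist a m) :
    G.dist a x + G.dist x m = G.dist a m := by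
  have key {y : V} (hy : y ∈ pathSet G a b) : ∃ (w₁ : G.Walk a y) (w₂ : G.Walk y b),
      w₁.length = G.dist a y ∧ w₂.length = G.dist y b ∧ (w₁.append w₂).IsPath := by
    obtain ⟨w₁, hw₁⟩ := hc.exists_walk_length_eq_dist a y
    obtain ⟨w₂, hw₂⟩ := hc.exists_walk_length_eq_dist y b
    refine ⟨w₁, w₂, hw₁, hw₂, Walk.isPath_of_length_eq_dist _ ?_⟩
    rw [Walk.length_append, hw₁, hw₂]
    exact hy
  obtain ⟨x₁, x₂, hx₁, -, hxp⟩ := key hx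
  obtain ⟨m₁, m₂, hm₁, -, hmp⟩ := key hm
  have heq : x₁.append x₂ = m₁.append m₂ :=
    congrArg Subtype.val ((ha.subsingleton_path a b).elim ⟨_, hxp⟩ ⟨_, hmp⟩)
  have hget : m₁.getVert (G.dist a x) = x := by
    have h1 := congrArg (fun w => w.getVert (G.dist a x)) heq
    simp only [Walk.getVert_append'] at h1
    rw [if_pos hx₁.ge, if_pos (hm₁ ▸ h), ← hx₁, Walk.getVert_length] at h1
    rw [← hx₁]
    exact h1.symm
  have hdrop := dist_le (m₁.drop (G.dist a x))
  rw [Walk.drop_length, hm₁, hget] at hdrop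
  have := hc.dist_triangle (u := a) (v := x) (w := m)
  omega

/-- Any three vertices of a tree have a median. -/
theorem exists_median (hc : G.Connected) (ha : G.IsAcyclic) (a b u : V) :
    ∃ m ∈ pathSet G a b, m ∈ pathSet G u a ∧ m ∈ pathSet G u b := by
  obtain ⟨m, hm, hmin⟩ : ∃ m ∈ pathSet G a b, ∀ y ∈ pathSet G a b, G.dist u m ≤ G.dist u y := by
    have hne : (pathSet G a b).Nonempty := ⟨a, by simp [pathSet]⟩
    exact ⟨_, Function.argminOn_mem (G.dist u) _ hne,
      fun y hy => Function.argminOn_le (G.dist u) _ hy⟩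
  have hclose {y : V} (hy : y ∈ pathSet G a b) (hym : y ∈ pathSet G u m) : y = m := by
    have := hmin y hy
    simp only [pathSet, Set.mem_ofPred_eq] at hym
    exact hc.dist_eq_zero_iff.1 (by omega)
  refine ⟨m, hm, dist_add_of_inter_subset hc ha fun y hy₁ hy₂ => hclose ?_ hy₁,
    dist_add_of_inter_subset hc ha fun y hy₁ hy₂ => hclose ?_ hy₁⟩
  all_goals
    have h1 := hc.dist_triangle (u := a) (v := y) (w := b)
    simp only [pathSet, Set.mem_ofPred_eq] at hm hy₂ ⊢
  · have h2 := hc.dist_triangle (u := y) (v := m) (w := b)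
    rw [G.dist_comm (u := m) (v := y), G.dist_comm (u := y) (v := a),
      G.dist_comm (u := m) (v := a)] at hy₂
    omega
  · have h2 := hc.dist_triangle (u := a) (v := m) (w := y)
    omega

/-- `p` is the gate of `u` in `P`: a vertex of `P` lying on a geodesic from `u` to every vertex
of `P`. -/
def IsGate (G : SimpleGraph V) (P : Set V) (u p : V) : Prop :=
  p ∈ P ∧ ∀ x ∈ P, G.dist u p + G.dist p x = G.dist u x

theorem exists_isGate (hc : G.Connected) (ha : G.IsAcyclic) (a b u : V) :
    ∃ p, IsGate G (pathSet G a b) u p := by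
  obtain ⟨m, hm, hma, hmb⟩ := exists_median hc ha a b u
  refine ⟨m, hm, fun x hx => ?_⟩
  have h1 := hc.dist_triangle (u := u) (v := m) (w := x)
  have hxm := G.dist_comm (u := x) (v := m)
  have ham := G.dist_comm (u := a) (v := m)
  have hax := G.dist_comm (u := a) (v := x)
  have h2 := hc.dist_triangle (u := u) (v := x) (w := a)
  have h3 := hc.dist_triangle (u := u) (v := x) (w := b)
  have h4 := dist_add_of_dist_le hc ha hx hm
  have h5 := dist_add_of_dist_le hc ha hm hx
  simp only [pathSet, Set.mem_ofPred_eq] at hx hm hma hmb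
  omega

theorem IsGate.of_mem_pathSet (hc : G.Connected) {P : Set V} {u p v : V} (h : IsGate G P u p)
    (hv : v ∈ pathSet G u p) : IsGate G P v p := by
  refine ⟨h.1, fun x hx => ?_⟩
  have h1 := h.2 x hx
  have h2 := hc.dist_triangle (u := u) (v := v) (w := x)
  have h3 := hc.dist_triangle (u := v) (v := p) (w := x)
  simp only [pathSet, Set.mem_ofPred_eq] at hv
  omega

theorem IsGate.distToSet_eq {P : Set V} {u p : V} (h : IsGate G P u p) :
    distToSet G u P = G.dist u p := by
  refine le_antisymm (Nat.sInf_le ⟨p, h.1, rfl⟩) (le_csInf ⟨_, p, h.1, rfl⟩ ?_)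
  rintro _ ⟨x, hx, rfl⟩
  have := h.2 x hx
  omega

theorem IsGate.dist_eq (hc : G.Connected) (ha : G.IsAcyclic) {P : Set V} {u w p q : V}
    (hp : IsGate G P u p) (hq : IsGate G P w q) (hne : p ≠ q) :
    G.dist u w = G.dist u p + G.dist p q + G.dist q w := by
  have huq := hp.2 q hq.1
  rw [huq]
  refine (dist_add_of_inter_subset hc ha fun y hy₁ hy₂ => ?_).symm
  have hyw : y ∈ pathSet G w q := by
    simp only [pathSet, Set.mem_ofPred_eq] at hy₂ ⊢
    rw [G.dist_comm (u := w) (v := y), G.dist_comm (u := y) (v := q),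
      G.dist_comm (u := w) (v := q)]
    omega
  have hyp := (hq.of_mem_pathSet hc hyw).2 p hp.1
  have hpos := hc.pos_dist_of_ne hne
  have h1 := dist_add_of_dist_le hc ha hy₁ huq
  have h2 := dist_add_of_dist_le hc ha huq hy₁
  simp only [pathSet, Set.mem_ofPred_eq] at hy₁
  rw [G.dist_comm (u := q) (v := p)] at hyp
  rw [G.dist_comm (u := p) (v := y)] at h2
  exact hc.dist_eq_zero_iff.1 (by omega)

theorem IsGate.mem_subtree (hc : G.Connected) {a b u p : V}
    (h : IsGate G (pathSet G a b) u p) : p ∈ subtree G a b u := by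
  obtain ⟨k, hk⟩ : ∃ k, G.dist u p = k := ⟨_, rfl⟩
  induction k generalizing u with
  | zero =>
    rw [hc.dist_eq_zero_iff.1 hk]
    exact Relation.ReflTransGen.refl
  | succ k ih =>
    obtain ⟨w, hw⟩ := hc.exists_walk_length_eq_dist u p
    cases w with
    | nil => simp at hk
    | @cons _ v _ huv w =>
      rw [Walk.length_cons] at hw
      have h1 := dist_le w
      have h2 := hc.dist_triangle (u := u) (v := v) (w := p)
      have h3 := dist_eq_one_iff_adj.2 huv
      refine Relation.ReflTransGen.head ⟨huv, fun hmem => ?_⟩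
        (ih (h.of_mem_pathSet hc ?_) (by omega))
      · have := h.2 u hmem.1
        rw [dist_self] at this
        omega
      · simp only [pathSet, Set.mem_ofPred_eq]
        omega

theorem subtree_eq_of_mem {a b u p : V} (h : p ∈ subtree G a b u) :
    subtree G a b u = subtree G a b p := by
  have hsymm : Std.Symm
      (fun x y => G.Adj x y ∧ ¬(x ∈ pathSet G a b ∧ y ∈ pathSet G a b)) :=
    ⟨fun x y hxy => ⟨hxy.1.symm, fun hm => hxy.2 hm.symm⟩⟩
  ext v
  exact ⟨fun hv => (Relation.ReflTransGen.stdSymm.symm _ _ h).trans hv, fun hv => h.trans hv⟩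

end SimpleGraph

/-- every TMON and ATC (= ADR and 1-TSI) mechanism on a discrete
tree is strategyproof. -/
theorem tmon_atc_implies_sp {V : Type*} {n : ℕ} (G : SimpleGraph V)
    (hT : IsDiscreteTree G) (f : (Fin n → V) → V)
    (hTMON : TMON G f) (hADR : ADR G f) (hTSI : OneTSI G f) :
    Strategyproof G f := by
  obtain ⟨hc, ha, -⟩ := hT
  intro a i b
  by_cases hsub : subtree G (a i) b (f a) = subtree G (a i) b (f (update a i b))
  · by_cases hne : f a = f (update a i b)
    · rw [← hne]
    obtain ⟨z, hz, hzu, hzw⟩ := SimpleGraph.exists_median hc ha (f a) (f (update a i b)) (a i)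
    have h := hADR a i b hne hsub z ⟨⟨hzu, hzw⟩, hz⟩
    simp only [pathSet, Set.mem_ofPred_eq] at hzu hzw
    rw [G.dist_comm (u := z)] at hzu hzw
    omega
  · obtain ⟨p, hp⟩ := SimpleGraph.exists_isGate hc ha (a i) b (f a)
    obtain ⟨q, hq⟩ := SimpleGraph.exists_isGate hc ha (a i) b (f (update a i b))
    have hpq : p ≠ q := by
      rintro rfl
      exact hsub ((SimpleGraph.subtree_eq_of_mem (hp.mem_subtree hc)).trans
        (SimpleGraph.subtree_eq_of_mem (hq.mem_subtree hc)).symm)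
    have hd := not_lt.1 fun h => hsub (hTSI a i b h)
    rw [hp.distToSet_eq] at hd
    have huw := hp.dist_eq hc ha hq hpq
    have huq := hp.2 q hq.1
    have hwp := hq.2 p hp.1
    have hpos := hc.pos_dist_of_ne hpq
    have hai := hq.2 (a i) (by simp [pathSet])
    have htri := hc.dist_triangle (u := a i) (v := p) (w := f a)
    rw [G.dist_comm (u := p) (v := f a)] at htri
    rw [G.dist_comm (u := q) (v := a i), G.dist_comm (u := f (update a i b)) (v := a i)] at hai
    rw [G.dist_comm (u := q) (v := p), G.dist_comm (u := f (update a i b)) (v := p)] at hwp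
    rw [G.dist_comm (u := q) (v := f (update a i b))] at huw
    have hmono := (hTMON a i b p ⟨hp.1, by simp only [pathSet, Set.mem_ofPred_eq]; omega⟩ q
      ⟨hq.1, by
        simp only [pathSet, Set.mem_ofPred_eq]
        rw [G.dist_comm (u := q)]
        omega⟩).2 (by omega)
    omega
end
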